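/- Let a ∈ ℝ, a ≠ 0. Then for all x ∈ ℝ \ ℤ, the symmetric limit lim_{K→∞} ∑_{k=−K}^K (e^a − 1)/(a − 2πik) · e^{2πikx} equals e^{a·frac(x)}, where frac(x) denotes the fractional part of x; and for x ∈ ℤ the same limit equals (e^a + 1)/2. -/

import Mathlib

open Filter

open Complex MeasureTheory in
/-- The Riemann-Lebesgue lemma on the unit interval. -/
theorem tendsto_intervalIntegral_mul_exp_cocompact (g : ℝ → ℂ) :
    Tendsto (fun w : ℝ => ∫ t in (0 : ℝ)..1, g t * exp (-(2 * Real.pi * I * w * t)))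
      (cocompact ℝ) (nhds 0) := by
  refine (Real.tendsto_integral_exp_smul_cocompact
    (Set.indicator (Set.Ioc (0 : ℝ) 1) g)).congr fun w => ?_
  rw [intervalIntegral.integral_of_le zero_le_one, ← integral_indicator measurableSet_Ioc]
  congr 1 with t
  by_cases ht : t ∈ Set.Ioc (0 : ℝ) 1
  · simp only [Set.indicator_of_mem ht, Circle.smul_def, Real.fourierChar_apply, smul_eq_mul]
    rw [mul_comm]
    congr 2
    push_cast
    ring
  · simp [Set.indicator_of_notMem ht]

theorem Finset.sum_Icc_neg_succ {M : Type*} [AddCommMonoid M] (u : ℤ → M) (K : ℕ) :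
    ∑ k ∈ Finset.Icc (-((K + 1 : ℕ) : ℤ)) ((K + 1 : ℕ) : ℤ), u k =
      ∑ k ∈ Finset.Icc (-(K : ℤ)) (K : ℤ), u k + (u (K + 1) + u (-(K + 1))) := by
  have h : Finset.Icc (-((K + 1 : ℕ) : ℤ)) ((K + 1 : ℕ) : ℤ) =
      insert ((K : ℤ) + 1) (insert (-((K : ℤ) + 1)) (Finset.Icc (-(K : ℤ)) (K : ℤ))) := by
    ext k
    simp only [Finset.mem_Icc, Finset.mem_insert]
    lia
  rw [h, Finset.sum_insert (by simp only [Finset.mem_insert, Finset.mem_Icc]; lia),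
    Finset.sum_insert (by simp only [Finset.mem_Icc]; lia), ← add_assoc, add_comm]

open Complex in
theorem integral_exp_two_pi_int_mul (k : ℤ) (x : ℝ) :
    ∫ t in (0 : ℝ)..1, exp (-(2 * Real.pi * I * k * (t - x))) = if k = 0 then 1 else 0 := by
  split_ifs with hk
  · simp [hk]
  · have hc : -(2 * Real.pi * I * k) ≠ 0 := by
      simp [hk, Real.pi_ne_zero]
    have h (t : ℝ) : exp (-(2 * Real.pi * I * k * (t - x))) =
        exp (-(2 * Real.pi * I * k) * t) * exp (2 * Real.pi * I * k * x) := by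
      rw [← exp_add]
      ring_nf
    have h1 : exp (-(2 * Real.pi * I * k)) = 1 :=
      exp_eq_one_iff.2 ⟨-k, by push_cast; ring⟩
    simp_rw [h]
    rw [intervalIntegral.integral_mul_const, integral_exp_mul_complex hc]
    simp [h1]

open Complex in
/-- Dini-type criterion: if `(f t - L) / (e^{2πi(t-x)} - 1)` is integrable on the unit interval,
then the symmetric partial sums of the Fourier series of `f` at `x` converge to `L`. -/
theorem tendsto_fourier_partial_sum_of_eq_mul {f g : ℝ → ℂ} {L : ℂ} {x : ℝ}
    (hg : IntervalIntegrable g MeasureTheory.volume 0 1)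
    (hfg : ∀ t ∈ Set.Icc (0 : ℝ) 1, f t - L = (exp (2 * Real.pi * I * (t - x)) - 1) * g t) :
    Tendsto (fun K : ℕ => ∑ k ∈ Finset.Icc (-(K : ℤ)) (K : ℤ),
        (∫ t in (0 : ℝ)..1, f t * exp (-(2 * Real.pi * I * k * t))) *
          exp (2 * Real.pi * I * k * x))
      atTop (nhds L) := by
  set G : ℤ → ℂ := fun k => ∫ t in (0 : ℝ)..1, g t * exp (-(2 * Real.pi * I * k * (t - x)))
    with hG
  have hint (k : ℤ) : IntervalIntegrable
      (fun t : ℝ => g t * exp (-(2 * Real.pi * I * k * (t - x)))) MeasureTheory.volume 0 1 :=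
    hg.mul_continuousOn (by fun_prop)
  have hterm (k : ℤ) : (∫ t in (0 : ℝ)..1, f t * exp (-(2 * Real.pi * I * k * t))) *
      exp (2 * Real.pi * I * k * x) = G (k - 1) - G k + if k = 0 then L else 0 := by
    have hL : (if k = 0 then L else 0) =
        ∫ t in (0 : ℝ)..1, L * exp (-(2 * Real.pi * I * k * (t - x))) := by
      rw [intervalIntegral.integral_const_mul, integral_exp_two_pi_int_mul]
      simp
    rw [hL, ← intervalIntegral.integral_sub (hint _) (hint _), ← intervalIntegral.integral_add
      ((hint _).sub (hint _)) (Continuous.intervalIntegrable (by fun_prop) _ _),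
      ← intervalIntegral.integral_mul_const]
    refine intervalIntegral.integral_congr fun t ht => ?_
    rw [Set.uIcc_of_le zero_le_one] at ht
    have h1 : exp (-(2 * Real.pi * I * (k - 1 : ℤ) * (t - x))) =
        exp (2 * Real.pi * I * (t - x)) * exp (-(2 * Real.pi * I * k * (t - x))) := by
      rw [← exp_add]
      push_cast
      ring_nf
    have h2 : exp (-(2 * Real.pi * I * k * t)) * exp (2 * Real.pi * I * k * x) =
        exp (-(2 * Real.pi * I * k * (t - x))) := by
      rw [← exp_add]
      ring_nf
    simp only [h1, mul_assoc (f t), h2]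
    linear_combination exp (-(2 * Real.pi * I * k * (t - x))) * hfg t ht
  have hsum (K : ℕ) : ∑ k ∈ Finset.Icc (-(K : ℤ)) (K : ℤ),
      (∫ t in (0 : ℝ)..1, f t * exp (-(2 * Real.pi * I * k * t))) *
        exp (2 * Real.pi * I * k * x) = G (-(K : ℤ) - 1) - G K + L := by
    simp_rw [hterm]
    induction K with
    | zero => simp
    | succ K ih =>
      rw [Finset.sum_Icc_neg_succ, ih, if_neg (by lia), if_neg (by lia)]
      push_cast
      ring_nf
  have hRL : Tendsto G cofinite (nhds 0) := by
    have h := (tendsto_intervalIntegral_mul_exp_cocompact g).comp Int.tendsto_coe_cofinite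
    refine squeeze_zero_norm (fun k => le_of_eq ?_) (tendsto_zero_iff_norm_tendsto_zero.1 h)
    have h1 (t : ℝ) : g t * exp (-(2 * Real.pi * I * k * (t - x))) =
        g t * exp (-(2 * Real.pi * I * (k : ℝ) * t)) * exp ((2 * Real.pi * k * x : ℝ) * I) := by
      rw [mul_assoc (g t), ← exp_add]
      push_cast
      ring_nf
    simp only [hG, h1, intervalIntegral.integral_mul_const, norm_mul, norm_exp_ofReal_mul_I,
      mul_one, Function.comp_apply]
  simp_rw [hsum]
  have hneg : Function.Injective fun K : ℕ => -(K : ℤ) - 1 := fun m n h => by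
    simp only at h
    lia
  have hlim := (((hRL.comp hneg.tendsto_cofinite).sub
    (hRL.comp (Nat.cast_injective (R := ℤ)).tendsto_cofinite)).add_const L)
  rw [Nat.cofinite_eq_atTop] at hlim
  simpa using hlim

open Complex in
/-- A differentiable function on `ℝ` is represented by the symmetric partial sums of its Fourier
series on the unit interval at every interior point. -/
theorem tendsto_fourier_partial_sum_of_differentiable {f : ℝ → ℂ} (hf : Differentiable ℝ f)
    {x : ℝ} (hx : x ∈ Set.Ioo (0 : ℝ) 1) :
    Tendsto (fun K : ℕ => ∑ k ∈ Finset.Icc (-(K : ℤ)) (K : ℤ),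
        (∫ t in (0 : ℝ)..1, f t * exp (-(2 * Real.pi * I * k * t))) *
          exp (2 * Real.pi * I * k * x))
      atTop (nhds (f x)) := by
  have hcont {h : ℝ → ℂ} (hh : Differentiable ℝ h) : Continuous (dslope h x) :=
    continuousOn_univ.1 ((continuousOn_dslope univ_mem).2
      ⟨hh.continuous.continuousOn, hh x⟩)
  set e : ℝ → ℂ := fun t => exp (2 * Real.pi * I * (t - x)) with he
  have hder (t : ℝ) : HasDerivAt e (exp (2 * Real.pi * I * (t - x)) * (2 * Real.pi * I)) t := by
    simpa using (((hasDerivAt_id t).ofReal_comp.sub_const (x : ℂ)).const_mul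
      (2 * Real.pi * I : ℂ)).cexp
  have hed : Differentiable ℝ e := fun t => (hder t).differentiableAt
  have hex : e x = 1 := by simp [he]
  have hne (t : ℝ) (ht : t ∈ Set.Icc (0 : ℝ) 1) : dslope e x t ≠ 0 := by
    rcases eq_or_ne t x with rfl | htx
    · rw [dslope_same, (hder t).deriv]
      simp [Real.pi_ne_zero]
    · intro h0
      have h1 := sub_smul_dslope e x t
      rw [h0, smul_zero, hex, eq_comm, sub_eq_zero] at h1
      obtain ⟨n, hn⟩ := exp_eq_one_iff.1 h1
      have h2 : ((t - x : ℝ) : ℂ) = (n : ℝ) := by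
        refine mul_left_cancel₀ two_pi_I_ne_zero ?_
        push_cast
        rw [hn]
        ring
      have h3 : t - x = n := ofReal_injective h2
      have h4 : (n : ℝ) < 1 := by linarith [ht.2, hx.1]
      have h5 : (-1 : ℝ) < n := by linarith [ht.1, hx.2]
      have h6 : n = 0 := by
        have h7 : n < 1 := by exact_mod_cast h4
        have h8 : -1 < n := by exact_mod_cast h5
        lia
      rw [h6, Int.cast_zero, sub_eq_zero] at h3
      exact htx h3
  refine tendsto_fourier_partial_sum_of_eq_mul (g := fun t => dslope f x t / dslope e x t)
    (ContinuousOn.intervalIntegrable ?_) fun t ht => ?_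
  · rw [Set.uIcc_of_le zero_le_one]
    exact (hcont hf).continuousOn.div (hcont hed).continuousOn hne
  · have h1 : (t - x) • dslope e x t = exp (2 * Real.pi * I * (t - x)) - 1 := by
      rw [sub_smul_dslope, hex]
    rw [← h1, ← sub_smul_dslope f x t, real_smul, real_smul]
    field_simp [hne t ht]

open Complex in
theorem ofReal_sub_two_pi_I_mul_int_ne_zero {a : ℝ} (ha : a ≠ 0) (k : ℤ) :
    (a : ℂ) - 2 * Real.pi * I * k ≠ 0 := by
  intro h
  have := congrArg re h
  simp [ha] at this

open Complex in
theorem integral_exp_mul_exp_neg_two_pi_int {a : ℝ} (ha : a ≠ 0) (k : ℤ) :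
    ∫ t in (0 : ℝ)..1, exp (a * t) * exp (-(2 * Real.pi * I * k * t)) =
      ((Real.exp a - 1 : ℝ) : ℂ) / ((a : ℂ) - 2 * Real.pi * I * k) := by
  have h (t : ℝ) : exp (a * t) * exp (-(2 * Real.pi * I * k * t)) =
      exp ((a - 2 * Real.pi * I * k) * t) := by
    rw [← exp_add]
    ring_nf
  have h1 : exp (a - 2 * Real.pi * I * k) = exp a := by
    rw [exp_eq_exp_iff_exists_int]
    exact ⟨-k, by push_cast; ring⟩
  simp_rw [h]
  rw [integral_exp_mul_complex (ofReal_sub_two_pi_I_mul_int_ne_zero ha k)]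
  simp [h1]

open Complex in
/-- The Mittag-Leffler expansion of `z ↦ coth (z / 2) / 2` at real points. -/
theorem tendsto_sum_exp_sub_one_div_sub_two_pi_I_mul {a : ℝ} (ha : a ≠ 0) :
    Tendsto (fun K : ℕ => ∑ k ∈ Finset.Icc (-(K : ℤ)) (K : ℤ),
        ((Real.exp a - 1 : ℝ) : ℂ) / ((a : ℂ) - 2 * Real.pi * I * k))
      atTop (nhds (((Real.exp a + 1) / 2 : ℝ) : ℂ)) := by
  set z : ℂ := a / (2 * Real.pi * I) with hz
  have hzmul : 2 * Real.pi * I * z = a := mul_div_cancel₀ _ two_pi_I_ne_zero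
  have hsub (k : ℤ) : z - k ≠ 0 := fun h =>
    ofReal_sub_two_pi_I_mul_int_ne_zero ha k (by linear_combination -hzmul + 2 * Real.pi * I * h)
  have hzc : z ∈ integerComplement := by
    rintro ⟨k, hk⟩
    exact hsub k (by rw [hk, sub_self])
  have hE : exp a - 1 ≠ 0 := by
    rw [← ofReal_exp, ← ofReal_one, ← ofReal_sub, ofReal_ne_zero, sub_ne_zero]
    simpa using ha
  have hterm (k : ℤ) : ((Real.exp a - 1 : ℝ) : ℂ) / ((a : ℂ) - 2 * Real.pi * I * k) =
      (exp a - 1) / (2 * Real.pi * I) * (1 / (z - k)) := by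
    rw [← hzmul, ← mul_sub, div_mul_div_comm, mul_one, hzmul]
    push_cast
    rfl
  have hsum (K : ℕ) : ∑ k ∈ Finset.Icc (-(K : ℤ)) (K : ℤ), 1 / (z - k) =
      ∑ j ∈ Finset.range K, cotTerm z j + 1 / z := by
    induction K with
    | zero => simp
    | succ K ih =>
      rw [Finset.sum_Icc_neg_succ, ih, Finset.sum_range_succ, cotTerm]
      push_cast
      ring
  simp_rw [hterm, ← Finset.mul_sum, hsum]
  have hlim := ((tendsto_logDeriv_euler_cot_sub hzc).add_const (1 / z)).const_mul
    ((exp a - 1) / (2 * Real.pi * I))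
  convert hlim using 2
  have hE' : 1 - exp a ≠ 0 := by rwa [← neg_sub, neg_ne_zero]
  rw [sub_add_cancel, cot_pi_eq_exp_ratio, hzmul]
  have hpi : (Real.pi : ℂ) ≠ 0 := ofReal_ne_zero.2 Real.pi_ne_zero
  push_cast
  field_simp
  rw [I_sq]
  ring

open Complex in
theorem exp_two_pi_I_int_mul_fract (k : ℤ) (x : ℝ) :
    exp (2 * Real.pi * I * k * (Int.fract x : ℝ)) = exp (2 * Real.pi * I * k * x) := by
  rw [exp_eq_exp_iff_exists_int]
  refine ⟨-(k * ⌊x⌋), ?_⟩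
  rw [Int.fract]
  push_cast
  ring

/-- Fourier expansion of `x ↦ e^{a·frac x}`: the symmetric partial sums
`∑_{|k|≤K} (e^a-1)/(a-2πik) e^{2πikx}` converge to `e^{a·frac x}` for `x ∉ ℤ`,
and to `(e^a+1)/2` for `x ∈ ℤ`. -/
theorem stmt_13 (a : ℝ) (ha : a ≠ 0) (x : ℝ) :
    ((¬ ∃ m : ℤ, x = m) →
      Tendsto (fun K : ℕ =>
          ∑ k ∈ Finset.Icc (-(K : ℤ)) (K : ℤ),
            ((Real.exp a - 1 : ℝ) : ℂ) / ((a : ℂ) - 2 * Real.pi * Complex.I * (k : ℂ)) *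
              Complex.exp (2 * Real.pi * Complex.I * (k : ℂ) * (x : ℂ)))
        atTop (nhds ((Real.exp (a * Int.fract x) : ℝ) : ℂ))) ∧
    ((∃ m : ℤ, x = m) →
      Tendsto (fun K : ℕ =>
          ∑ k ∈ Finset.Icc (-(K : ℤ)) (K : ℤ),
            ((Real.exp a - 1 : ℝ) : ℂ) / ((a : ℂ) - 2 * Real.pi * Complex.I * (k : ℂ)) *
              Complex.exp (2 * Real.pi * Complex.I * (k : ℂ) * (x : ℂ)))
        atTop (nhds (((Real.exp a + 1) / 2 : ℝ) : ℂ))) := by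
  constructor
  · intro hx
    have hpos : 0 < Int.fract x :=
      Int.fract_pos.2 fun h => hx ⟨⌊x⌋, h⟩
    have hf : Differentiable ℝ fun t : ℝ => Complex.exp (a * t) := fun t =>
      ((((hasDerivAt_id t).ofReal_comp).const_mul (a : ℂ)).cexp).differentiableAt
    have h := tendsto_fourier_partial_sum_of_differentiable hf ⟨hpos, Int.fract_lt_one x⟩
    simp_rw [integral_exp_mul_exp_neg_two_pi_int ha, exp_two_pi_I_int_mul_fract] at h
    simpa using h
  · rintro ⟨m, rfl⟩
    refine (tendsto_sum_exp_sub_one_div_sub_two_pi_I_mul ha).congr fun K =>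
      Finset.sum_congr rfl fun k _ => ?_
    have h : Complex.exp (2 * Real.pi * Complex.I * k * ((m : ℝ) : ℂ)) = 1 :=
      Complex.exp_eq_one_iff.2 ⟨k * m, by push_cast; ring⟩
    rw [h, mul_one]
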